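/- For every integer n > 1, B(n) ≤ n^{τ(n)} · A₀(n)^{τ(n)}. -/

import Mathlib

open Polynomial Filter
open scoped Classical

/-- Height of an integer polynomial: max absolute value of coefficients. -/
def polyHeight (f : Polynomial ℤ) : ℕ := f.support.sup fun i => (f.coeff i).natAbs

/-- A(n): height of the n-th cyclotomic polynomial. -/
noncomputable def A (n : ℕ) : ℕ := polyHeight (Polynomial.cyclotomic n ℤ)

/-- B(n): max height over all integer polynomial divisors of x^n - 1. -/
noncomputable def B (n : ℕ) : ℕ :=
  sSup {h : ℕ | ∃ f : Polynomial ℤ, f ∣ (Polynomial.X ^ n - 1) ∧ polyHeight f = h}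

/-- A₀(n): max of A(d) over positive divisors d of n. -/
noncomputable def A0 (n : ℕ) : ℕ := n.divisors.sup A

/-- τ(n): number of positive divisors of n. -/
def tau (n : ℕ) : ℕ := n.divisors.card

/-- ω(n): number of distinct prime factors of n. -/
def omegaCount (n : ℕ) : ℕ := n.primeFactors.card

/-- p_k(n): the k-th largest distinct prime factor of n (1-indexed), or 1 if k > ω(n). -/
def pk (n k : ℕ) : ℕ :=
  if k ≤ n.primeFactors.card then
    (n.primeFactors.sort (· ≤ ·)).getD (n.primeFactors.card - k) 1
  else 1

/-- ω([t,x],n): number of distinct prime factors of n lying in the real interval [t,x]. -/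
noncomputable def omegaInterval (t x : ℝ) (n : ℕ) : ℕ :=
  (n.primeFactors.filter fun p : ℕ => t ≤ (p : ℝ) ∧ (p : ℝ) ≤ x).card

/-- rad(n): the radical (product of the distinct prime factors) of n. -/
def rad (n : ℕ) : ℕ := ∏ p ∈ n.primeFactors, p

theorem polyHeight_le_iff {f : ℤ[X]} {K : ℕ} :
    polyHeight f ≤ K ↔ ∀ i, (f.coeff i).natAbs ≤ K := by
  unfold polyHeight
  rw [Finset.sup_le_iff]
  refine ⟨fun h i => ?_, fun h i _ => h i⟩
  by_cases hi : f.coeff i = 0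
  · simp [hi]
  · exact h i (mem_support_iff.mpr hi)

theorem natAbs_coeff_le_polyHeight (f : ℤ[X]) (i : ℕ) : (f.coeff i).natAbs ≤ polyHeight f :=
  polyHeight_le_iff.mp le_rfl i

theorem polyHeight_mul_le (g h : ℤ[X]) :
    polyHeight (g * h) ≤ (g.natDegree + 1) * polyHeight g * polyHeight h := by
  rw [polyHeight_le_iff]
  intro k
  have hcoeff : (g * h).coeff k = ∑ i ∈ Finset.range (g.natDegree + 1),
      g.coeff i * (X ^ i * h).coeff k := by
    conv_lhs => rw [g.as_sum_range_C_mul_X_pow, Finset.sum_mul, finsetSum_coeff]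
    simp only [mul_assoc, coeff_C_mul]
  calc ((g * h).coeff k).natAbs
      ≤ ∑ i ∈ Finset.range (g.natDegree + 1), (g.coeff i * (X ^ i * h).coeff k).natAbs := by
        rw [hcoeff]
        exact Int.natAbs_sum_le _ _
    _ ≤ ∑ _i ∈ Finset.range (g.natDegree + 1), polyHeight g * polyHeight h := by
        refine Finset.sum_le_sum fun i _ => ?_
        rw [Int.natAbs_mul, coeff_X_pow_mul']
        refine Nat.mul_le_mul (natAbs_coeff_le_polyHeight g i) ?_
        split_ifs
        · exact natAbs_coeff_le_polyHeight h _
        · simp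
    _ = (g.natDegree + 1) * polyHeight g * polyHeight h := by simp [mul_assoc]

theorem Polynomial.Monic.one_le_polyHeight {f : ℤ[X]} (hf : f.Monic) : 1 ≤ polyHeight f := by
  simpa [hf.coeff_natDegree] using natAbs_coeff_le_polyHeight f f.natDegree

theorem polyHeight_eq_of_associated {f g : ℤ[X]} (h : Associated f g) :
    polyHeight f = polyHeight g := by
  obtain ⟨u, rfl⟩ := h
  obtain ⟨r, hr, hru⟩ := Polynomial.isUnit_iff.mp u.isUnit
  rw [← hru]
  refine le_antisymm (polyHeight_le_iff.mpr fun i => ?_) (polyHeight_le_iff.mpr fun i => ?_)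
  · simpa [Int.natAbs_mul, Int.isUnit_iff_natAbs_eq.mp hr] using
      natAbs_coeff_le_polyHeight (f * C r) i
  · simpa [Int.natAbs_mul, Int.isUnit_iff_natAbs_eq.mp hr] using natAbs_coeff_le_polyHeight f i

theorem polyHeight_one : polyHeight 1 = 1 := by
  refine le_antisymm (polyHeight_le_iff.mpr fun i => ?_) monic_one.one_le_polyHeight
  rw [coeff_one]
  split_ifs <;> simp

theorem polyHeight_eq_one_of_isUnit {f : ℤ[X]} (hf : IsUnit f) : polyHeight f = 1 := by
  rw [polyHeight_eq_of_associated (associated_one_iff_isUnit.mpr hf), polyHeight_one]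

theorem polyHeight_le_of_dvd_cyclotomic {d : ℕ} (hd : 0 < d) {g : ℤ[X]}
    (hg : g ∣ cyclotomic d ℤ) : polyHeight g ≤ A d := by
  rcases (cyclotomic.irreducible hd).dvd_iff.mp hg with h | h
  · rw [polyHeight_eq_one_of_isUnit h]
    exact (cyclotomic.monic d ℤ).one_le_polyHeight
  · exact (polyHeight_eq_of_associated h).ge

theorem totient_add_one_le_of_dvd {d n : ℕ} (hn : 1 < n) (hd : d ∣ n) : d.totient + 1 ≤ n := by
  rcases Nat.lt_or_ge 1 d with h | h
  · exact (Nat.totient_lt d h).trans_le (Nat.le_of_dvd (by lia) hd)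
  · have := Nat.totient_le d
    lia

theorem polyHeight_le_of_dvd_prod_cyclotomic {n : ℕ} (hn : 1 < n) {s : Finset ℕ}
    (hs : s ⊆ n.divisors) {f : ℤ[X]} (hf : f ∣ ∏ d ∈ s, cyclotomic d ℤ) :
    polyHeight f ≤ (n * A0 n) ^ s.card := by
  induction s using Finset.induction_on generalizing f with
  | empty =>
    rw [Finset.prod_empty] at hf
    simpa using (polyHeight_eq_one_of_isUnit (isUnit_of_dvd_one hf)).le
  | insert d s hds ih =>
    rw [Finset.insert_subset_iff] at hs
    rw [Finset.prod_insert hds] at hf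
    obtain ⟨g, h, hg, hh, rfl⟩ := exists_dvd_and_dvd_of_dvd_mul hf
    have hdn : d ∣ n := Nat.dvd_of_mem_divisors hs.1
    have hdeg : g.natDegree + 1 ≤ n :=
      calc g.natDegree + 1 ≤ (cyclotomic d ℤ).natDegree + 1 := by
            gcongr
            exact natDegree_le_of_dvd hg (cyclotomic_ne_zero d ℤ)
        _ ≤ n := by
            rw [natDegree_cyclotomic]
            exact totient_add_one_le_of_dvd hn hdn
    have hheight : polyHeight g ≤ A0 n :=
      (polyHeight_le_of_dvd_cyclotomic (Nat.pos_of_mem_divisors hs.1) hg).trans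
        (Finset.le_sup (f := A) hs.1)
    rw [Finset.card_insert_of_notMem hds, pow_succ']
    exact (polyHeight_mul_le g h).trans
      (Nat.mul_le_mul (Nat.mul_le_mul hdeg hheight) (ih hs.2 hh))

/-- For n > 1, B(n) ≤ n^{τ(n)} · A₀(n)^{τ(n)}. -/
theorem B_le_pow_tau_mul_A0_pow_tau (n : ℕ) (hn : 1 < n) :
    B n ≤ n ^ tau n * A0 n ^ tau n := by
  rw [← mul_pow]
  refine csSup_le ⟨polyHeight 1, 1, one_dvd _, rfl⟩ ?_
  rintro _ ⟨f, hf, rfl⟩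
  rw [← prod_cyclotomic_eq_X_pow_sub_one (by lia)] at hf
  exact polyHeight_le_of_dvd_prod_cyclotomic hn subset_rfl hf
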